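/- arXiv:1202.4798 — 5 statements merged into one kernel-verified Lean document; each statement's English description precedes it below -/
import Mathlib

section
/- Let x = P(x) be a PPS in SNF with n variables and least fixed point q* > 0. If y ∈ ℝ^n satisfies 0 ≤ y ≤ q* and y < 1 (coordinatewise), then the spectral radius of the Jacobian satisfies ρ(P'(y)) < 1; consequently the matrix (I − P'(y)) is nonsingular and (I − P'(y))^{-1} = Σ_{k=0}^∞ P'(y)^k is entrywise nonnegative. -/
open Matrix Finset

namespace PPS

/-- One equation of a max/min PPS in simple normal form (SNF):
form L (linear), form Q (product of two variables), or form M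
(max or min of two variables, according to the kind of the system). -/
inductive Eqn (n : ℕ) where
  | lin (a0 : ℝ) (a : Fin n → ℝ) : Eqn n
  | quad (j k : Fin n) : Eqn n
  | m (j k : Fin n) : Eqn n

namespace Eqn

/-- Validity of the coefficients of a form-L equation: all coefficients,
including the constant term, are nonnegative and sum to at most 1. -/
def Valid {n : ℕ} : Eqn n → Prop
  | .lin a0 a => 0 ≤ a0 ∧ (∀ j, 0 ≤ a j) ∧ a0 + ∑ j, a j ≤ 1
  | _ => True

/-- Evaluate one equation; `isMax` says whether form-M equations are max or min. -/
def eval {n : ℕ} (isMax : Bool) : Eqn n → (Fin n → ℝ) → ℝ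
  | .lin a0 a, x => a0 + ∑ j, a j * x j
  | .quad j k, x => x j * x k
  | .m j k, x => if isMax then max (x j) (x k) else min (x j) (x k)

/-- An equation of form L or Q (no max/min). -/
def IsLinOrQuad {n : ℕ} : Eqn n → Prop
  | .m _ _ => False
  | _ => True

/-- Row of the Jacobian matrix of one (form L or Q) equation at the point `y`. -/
def jacRow {n : ℕ} : Eqn n → (Fin n → ℝ) → (Fin n → ℝ)
  | .lin _ a, _ => a
  | .quad j k, y => fun l => (if l = j then y k else 0) + (if l = k then y j else 0)
  | .m _ _, _ => fun _ => 0

end Eqn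

/-- A system of `n` equations in `n` variables, in SNF. -/
abbrev Sys (n : ℕ) : Type := Fin n → Eqn n

/-- All equations have valid (probabilistic) coefficients. -/
def SysValid {n : ℕ} (S : Sys n) : Prop := ∀ i, (S i).Valid

/-- A PPS: a system with no form-M equations. -/
def IsPPS {n : ℕ} (S : Sys n) : Prop := ∀ i, (S i).IsLinOrQuad

/-- The map `P : ℝ^n → ℝ^n` of the system. -/
def eval {n : ℕ} (isMax : Bool) (S : Sys n) (x : Fin n → ℝ) : Fin n → ℝ :=
  fun i => (S i).eval isMax x

/-- The Jacobian matrix `P'(y)`. -/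
def jac {n : ℕ} (S : Sys n) (y : Fin n → ℝ) : Matrix (Fin n) (Fin n) ℝ :=
  Matrix.of fun i l => (S i).jacRow y l

/-- `q` is the least fixed point of `x = P(x)` in `[0,1]^n`. -/
def IsLFP {n : ℕ} (isMax : Bool) (S : Sys n) (q : Fin n → ℝ) : Prop :=
  eval isMax S q = q ∧ (∀ i, 0 ≤ q i) ∧ (∀ i, q i ≤ 1) ∧
    (∀ q' : Fin n → ℝ, eval isMax S q' = q' → (∀ i, 0 ≤ q' i) → (∀ i, q' i ≤ 1) →
      ∀ i, q i ≤ q' i)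

/-- Applying a policy `σ` (a choice, for each form-M equation `max/min {x_j, x_k}`,
of one of the two variables: `true` picks `x_j`, `false` picks `x_k`) to the system,
yielding the PPS `x = P_σ(x)`. -/
def applyPolicy {n : ℕ} (S : Sys n) (σ : Fin n → Bool) : Sys n := fun i =>
  match S i with
  | .m j k => .lin 0 (fun l => if l = (if σ i then j else k) then 1 else 0)
  | e => e

/-- The linearization `P^y` of `P` at `y`: equations of form L and M are unchanged,
and a form-Q equation `x_j x_k` becomes `y_j x_k + x_j y_k - y_j y_k`. -/
def linEval {n : ℕ} (isMax : Bool) (S : Sys n) (y x : Fin n → ℝ) : Fin n → ℝ := fun i =>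
  match S i with
  | .quad j k => y j * x k + x j * y k - y j * y k
  | e => e.eval isMax x

/-- The Newton operator `N(y) = y + (I - P'(y))⁻¹ (P(y) - y)`. -/
noncomputable def newton {n : ℕ} (isMax : Bool) (S : Sys n) (y : Fin n → ℝ) : Fin n → ℝ :=
  y + (1 - jac S y)⁻¹ *ᵥ (eval isMax S y - y)

/-- the l∞ norm of a vector -/
noncomputable def vnorm {n : ℕ} (v : Fin n → ℝ) : ℝ := ⨆ i, |v i|

/-- the l∞ (max absolute row sum) norm of a matrix -/
noncomputable def mnorm {n : ℕ} (A : Matrix (Fin n) (Fin n) ℝ) : ℝ := ⨆ i, ∑ j, |A i j|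

end PPS

open Filter Topology

namespace PPS

variable {n : ℕ}

theorem sum_jacRow_quad_mul (j k : Fin n) (y u : Fin n → ℝ) :
    ∑ l, (Eqn.quad j k).jacRow y l * u l = y k * u j + y j * u k := by
  simp [Eqn.jacRow, add_mul, Finset.sum_add_distrib]

theorem jac_nonneg {S : Sys n} (hval : SysValid S) {y : Fin n → ℝ} (hy : ∀ i, 0 ≤ y i)
    (i j : Fin n) : 0 ≤ jac S y i j := by
  have hv := hval i
  simp only [jac, Matrix.of_apply]
  cases h : S i with
  | lin a0 a =>
    rw [h] at hv
    exact hv.2.1 j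
  | quad k l =>
    simp only [Eqn.jacRow]
    have := hy k
    have := hy l
    positivity
  | m k l => simp [Eqn.jacRow]

theorem eval_nonneg {S : Sys n} (hval : SysValid S) (hpps : IsPPS S) (b : Bool)
    {x : Fin n → ℝ} (hx : ∀ i, 0 ≤ x i) (i : Fin n) : 0 ≤ eval b S x i := by
  have hv := hval i
  have hp := hpps i
  simp only [eval]
  cases h : S i with
  | lin a0 a =>
    rw [h] at hv
    exact add_nonneg hv.1 (Finset.sum_nonneg fun j _ => mul_nonneg (hv.2.1 j) (hx j))
  | quad j k => exact mul_nonneg (hx j) (hx k)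
  | m j k =>
    rw [h] at hp
    exact hp.elim

theorem eval_mono {S : Sys n} (hval : SysValid S) (hpps : IsPPS S) (b : Bool)
    {x x' : Fin n → ℝ} (hx : ∀ i, 0 ≤ x i) (hxx : ∀ i, x i ≤ x' i) (i : Fin n) :
    eval b S x i ≤ eval b S x' i := by
  have hv := hval i
  have hp := hpps i
  simp only [eval]
  cases h : S i with
  | lin a0 a =>
    rw [h] at hv
    exact add_le_add le_rfl
      (Finset.sum_le_sum fun j _ => mul_le_mul_of_nonneg_left (hxx j) (hv.2.1 j))
  | quad j k => exact mul_le_mul (hxx j) (hxx k) (hx k) ((hx j).trans (hxx j))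
  | m j k =>
    rw [h] at hp
    exact hp.elim

/-- The least fixed point lies below every pre-fixed point (Knaster–Tarski). -/
theorem IsLFP.le_of_eval_le {S : Sys n} (hval : SysValid S) (hpps : IsPPS S) {b : Bool}
    {q : Fin n → ℝ} (hq : IsLFP b S q) {x : Fin n → ℝ} (hx0 : ∀ i, 0 ≤ x i)
    (hx1 : ∀ i, x i ≤ 1) (hx : ∀ i, eval b S x i ≤ x i) (i : Fin n) : q i ≤ x i := by
  have : Fact ((0 : Fin n → ℝ) ≤ x) := ⟨hx0⟩
  let f : Set.Icc (0 : Fin n → ℝ) x →o Set.Icc (0 : Fin n → ℝ) x :=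
    { toFun := fun z => ⟨eval b S z, fun i => eval_nonneg hval hpps b z.2.1 i,
        fun i => (eval_mono hval hpps b z.2.1 z.2.2 i).trans (hx i)⟩
      monotone' := fun z z' hz i => eval_mono hval hpps b z.2.1 hz i }
  have hfix : f f.lfp = f.lfp := f.map_lfp
  have hfix' : eval b S f.lfp.1 = f.lfp.1 := congrArg Subtype.val hfix
  exact (hq.2.2.2 f.lfp.1 hfix' f.lfp.2.1 (fun j => (f.lfp.2.2 j).trans (hx1 j)) i).trans
    (f.lfp.2.2 i)

theorem IsLFP.eq_zero_of_eval_sub_le {S : Sys n} (hval : SysValid S) (hpps : IsPPS S) {b : Bool}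
    {q : Fin n → ℝ} (hq : IsLFP b S q) {w : Fin n → ℝ} (hw : ∀ i, 0 ≤ w i) {ε : ℝ} (hε : 0 < ε)
    (hle : ∀ i, ε * w i ≤ q i)
    (h : ∀ i, eval b S (fun j => q j - ε * w j) i ≤ q i - ε * w i) (i : Fin n) : w i = 0 := by
  have hεw : ∀ i, 0 ≤ ε * w i := fun i => mul_nonneg hε.le (hw i)
  have := hq.le_of_eval_le hval hpps (x := fun j => q j - ε * w j)
    (fun i => sub_nonneg.2 (hle i)) (fun i => by linarith [hq.2.2.1 i, hεw i]) h i
  have h0 : ε * w i = 0 := le_antisymm (by simpa using this) (hεw i)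
  exact (mul_eq_zero.1 h0).resolve_left hε.ne'

theorem exists_pos_forall_mul_le (w : Fin n → ℝ) {g : Fin n → ℝ} (hg : ∀ i, 0 < g i) :
    ∃ ε > 0, ∀ i, ε * w i ≤ g i := by
  have h : ∀ᶠ ε in 𝓝[>] (0 : ℝ), ∀ i, ε * w i ≤ g i := by
    refine eventually_all.2 fun i => ?_
    have ht : Tendsto (fun ε : ℝ => ε * w i) (𝓝[>] 0) (𝓝 0) := by
      have : Tendsto (fun ε : ℝ => ε * w i) (𝓝 0) (𝓝 (0 * w i)) :=
        (continuous_id.mul continuous_const).tendsto 0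
      rw [zero_mul] at this
      exact this.mono_left nhdsWithin_le_nhds
    exact (ht.eventually (gt_mem_nhds (hg i))).mono fun _ h => h.le
  obtain ⟨ε, h1, h2⟩ := (h.and self_mem_nhdsWithin).exists
  exact ⟨ε, h2, h1⟩

/-- Rows of `P'(y)` applied to `1 - q`: at most `1 - q i`, with equality only for
linear equations. -/
theorem sum_jac_mul_one_sub_le {S : Sys n} (hval : SysValid S) (hpps : IsPPS S) {b : Bool}
    {q : Fin n → ℝ} (hq : IsLFP b S q) {y : Fin n → ℝ}
    (hyq : ∀ i, y i ≤ q i) (hy1 : ∀ i, y i < 1) (i : Fin n) :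
    ∑ j, jac S y i j * (1 - q j) ≤ 1 - q i ∧
      (q i < 1 → ∑ j, jac S y i j * (1 - q j) = 1 - q i → ∃ a0 a, S i = .lin a0 a) := by
  have hv := hval i
  have hp := hpps i
  have hfix := congrFun hq.1 i
  simp only [eval] at hfix
  simp only [jac, Matrix.of_apply]
  cases h : S i with
  | lin a0 a =>
    refine ⟨?_, fun _ _ => ⟨a0, a, rfl⟩⟩
    rw [h] at hv hfix
    simp only [Eqn.eval] at hfix
    simp only [Eqn.jacRow, mul_sub, mul_one, Finset.sum_sub_distrib]
    linarith [hv.2.2]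
  | quad j k =>
    rw [h] at hfix
    simp only [Eqn.eval] at hfix
    rw [sum_jacRow_quad_mul, ← hfix]
    have hj := hq.2.2.1 j
    have hk := hq.2.2.1 k
    have e1 := mul_nonneg (sub_nonneg.2 (hyq k)) (sub_nonneg.2 hj)
    have e2 := mul_nonneg (sub_nonneg.2 (hyq j)) (sub_nonneg.2 hk)
    have e3 := mul_nonneg (sub_nonneg.2 hj) (sub_nonneg.2 hk)
    refine ⟨by nlinarith, fun hlt heq => ?_⟩
    exfalso
    have e3' : (1 - q j) * (1 - q k) = 0 := by nlinarith
    have e1' : (q k - y k) * (1 - q j) = 0 := by nlinarith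
    have e2' : (q j - y j) * (1 - q k) = 0 := by nlinarith
    rcases mul_eq_zero.1 e3' with h1 | h1
    · rcases mul_eq_zero.1 e2' with h2 | h2
      · linarith [hy1 j]
      · nlinarith
    · rcases mul_eq_zero.1 e1' with h2 | h2
      · linarith [hy1 k]
      · nlinarith
  | m j k =>
    rw [h] at hp
    exact hp.elim

/-- A subinvariant nonnegative vector supported on `{q = 1}` vanishes. -/
theorem eq_zero_of_le_mulVec_of_support {S : Sys n} (hval : SysValid S) (hpps : IsPPS S) {b : Bool}
    {q : Fin n → ℝ} (hq : IsLFP b S q) (hqpos : ∀ i, 0 < q i) {y : Fin n → ℝ}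
    (hyq : ∀ i, y i ≤ q i) (hy1 : ∀ i, y i < 1)
    {u : Fin n → ℝ} (hu0 : ∀ i, 0 ≤ u i) (hu : ∀ i, u i ≤ ∑ j, jac S y i j * u j)
    (hsupp : ∀ i, q i < 1 → u i = 0) (i : Fin n) : u i = 0 := by
  obtain ⟨ε, hε, hle⟩ := exists_pos_forall_mul_le u
    (g := fun i => if q i < 1 then q i else min (q i) (1 - y i)) (fun i => by
      split_ifs
      · exact hqpos i
      · exact lt_min (hqpos i) (sub_pos.2 (hy1 i)))
  have hle1 : ∀ i, ε * u i ≤ q i := fun i => by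
    have := hle i
    split_ifs at this
    · exact this
    · exact this.trans (min_le_left _ _)
  have hley : ∀ i, y i ≤ q i - ε * u i := fun i => by
    have := hle i
    split_ifs at this with h
    · rw [hsupp i h]
      linarith [hyq i]
    · have h2 := this.trans (min_le_right _ _)
      linarith [not_lt.1 h]
  refine hq.eq_zero_of_eval_sub_le hval hpps hu0 hε hle1 (fun i => ?_) i
  have hp := hpps i
  have hfix := congrFun hq.1 i
  have hui := mul_le_mul_of_nonneg_left (hu i) hε.le
  simp only [eval] at hfix ⊢
  simp only [jac, Matrix.of_apply] at hui
  cases h : S i with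
  | lin a0 a =>
    rw [h] at hfix hui
    simp only [Eqn.eval, Eqn.jacRow] at hfix hui ⊢
    simp only [mul_sub, Finset.sum_sub_distrib]
    rw [Finset.mul_sum] at hui
    have : ∑ j, a j * (ε * u j) = ∑ j, ε * (a j * u j) :=
      Finset.sum_congr rfl fun j _ => by ring
    linarith
  | quad j k =>
    rw [h] at hfix hui
    rw [sum_jacRow_quad_mul] at hui
    simp only [Eqn.eval] at hfix ⊢
    have hεj := mul_nonneg hε.le (hu0 j)
    have hεk := mul_nonneg hε.le (hu0 k)
    have e1 := mul_le_mul_of_nonneg_right (hley k) hεj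
    have e2 := mul_le_mul_of_nonneg_right (hyq j) hεk
    nlinarith
  | m j k =>
    rw [h] at hp
    exact hp.elim

/-- A nonnegative vector `u` with `u ≤ P'(y) u` vanishes. -/
theorem eq_zero_of_le_mulVec {S : Sys n} (hval : SysValid S) (hpps : IsPPS S) {b : Bool}
    {q : Fin n → ℝ} (hq : IsLFP b S q) (hqpos : ∀ i, 0 < q i) {y : Fin n → ℝ}
    (hy0 : ∀ i, 0 ≤ y i) (hyq : ∀ i, y i ≤ q i) (hy1 : ∀ i, y i < 1)
    {u : Fin n → ℝ} (hu0 : ∀ i, 0 ≤ u i) (hu : ∀ i, u i ≤ ∑ j, jac S y i j * u j) (i : Fin n) :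
    u i = 0 := by
  have hA : ∀ i j, 0 ≤ jac S y i j := jac_nonneg hval hy0
  have hv0 : ∀ i, 0 ≤ 1 - q i := fun i => sub_nonneg.2 (hq.2.2.1 i)
  have hrow := sum_jac_mul_one_sub_le hval hpps hq hyq hy1
  have hone : ∀ i, ¬ q i < 1 → u i = 0 := by
    intro i hi
    have := eq_zero_of_le_mulVec_of_support hval hpps hq hqpos hyq hy1
      (u := fun j => if q j < 1 then 0 else u j)
      (fun j => by split_ifs <;> simp [hu0 j]) (fun j => by
        split_ifs with hj
        · exact Finset.sum_nonneg fun l _ => mul_nonneg (hA j l) (by split_ifs <;> simp [hu0 l])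
        · refine (hu j).trans (Finset.sum_le_sum fun l _ => ?_)
          split_ifs with hl
          · have hz : ∑ l, jac S y j l * (1 - q l) = 0 :=
              le_antisymm ((hrow j).1.trans (by linarith))
                (Finset.sum_nonneg fun l _ => mul_nonneg (hA j l) (hv0 l))
            have hz' := (Finset.sum_eq_zero_iff_of_nonneg
              (fun l _ => mul_nonneg (hA j l) (hv0 l))).1 hz l (Finset.mem_univ l)
            rcases mul_eq_zero.1 hz' with h0 | h0
            · simp [h0]
            · linarith
          · exact le_rfl) (fun j hj => if_pos hj) i
    simpa [hi] using this
  by_contra hne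
  have hqi : q i < 1 := by
    by_contra h
    exact hne (hone i h)
  obtain ⟨m, hmem, hmax⟩ := Finset.exists_max_image (Finset.univ.filter fun j => q j < 1)
    (fun j => u j / (1 - q j)) ⟨i, by simpa using hqi⟩
  simp only [Finset.mem_filter, Finset.mem_univ, true_and] at hmem hmax
  set c := u m / (1 - q m) with hc
  have hcpos : 0 < c := lt_of_lt_of_le
    (div_pos (lt_of_le_of_ne (hu0 i) (Ne.symm hne)) (sub_pos.2 hqi)) (hmax i hqi)
  have huc : ∀ j, u j ≤ c * (1 - q j) := fun j => by
    by_cases hj : q j < 1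
    · exact (div_le_iff₀ (sub_pos.2 hj)).1 (hmax j hj)
    · rw [hone j hj]
      exact mul_nonneg hcpos.le (hv0 j)
  have hum : u m = c * (1 - q m) := (div_mul_cancel₀ _ (sub_pos.2 hmem).ne').symm
  have htight : ∀ l, q l < 1 → u l = c * (1 - q l) →
      (∃ a0 a, S l = .lin a0 a) ∧ ∑ j, jac S y l j * u j = u l ∧
        ∀ j, jac S y l j * u j = jac S y l j * (c * (1 - q j)) := by
    intro l hl hul
    have hterm : ∀ j ∈ Finset.univ, jac S y l j * u j ≤ jac S y l j * (c * (1 - q j)) :=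
      fun j _ => mul_le_mul_of_nonneg_left (huc j) (hA l j)
    have h1 := Finset.sum_le_sum hterm
    have h2 : ∑ j, jac S y l j * (c * (1 - q j)) = c * ∑ j, jac S y l j * (1 - q j) := by
      rw [Finset.mul_sum]
      exact Finset.sum_congr rfl fun j _ => by ring
    have h3 := mul_le_mul_of_nonneg_left (hrow l).1 hcpos.le
    have h4 := hu l
    refine ⟨(hrow l).2 hl ?_, by linarith, fun j => ?_⟩
    · exact mul_left_cancel₀ hcpos.ne' (by linarith)
    · exact (Finset.sum_eq_sum_iff_of_le hterm).1 (by linarith) j (Finset.mem_univ j)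
  let w : Fin n → ℝ := fun j => if u j = c * (1 - q j) then u j else 0
  have hw0 : ∀ j, 0 ≤ w j := fun j => by
    simp only [w]
    split_ifs <;> simp [hu0 j]
  obtain ⟨ε, hε, hle⟩ := exists_pos_forall_mul_le w hqpos
  have hεw : ∀ j, 0 ≤ ε * w j := fun j => mul_nonneg hε.le (hw0 j)
  have hwm : w m = 0 := by
    refine hq.eq_zero_of_eval_sub_le hval hpps hw0 hε hle (fun l => ?_) m
    by_cases hl : q l < 1 ∧ u l = c * (1 - q l)
    · obtain ⟨⟨a0, a, hS⟩, hsum, hall⟩ := htight l hl.1 hl.2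
      have hwl : w l = u l := if_pos hl.2
      have hfix := congrFun hq.1 l
      simp only [eval, hS, Eqn.eval] at hfix ⊢
      have hj : ∀ j, jac S y l j = a j := fun j => by simp [jac, hS, Eqn.jacRow]
      simp only [hj] at hsum hall
      have haw : ∀ j, a j * w j = a j * u j := fun j => by
        simp only [w]
        split_ifs with h
        · rfl
        · rcases mul_eq_mul_left_iff.1 (hall j) with h' | h'
          · exact absurd h' h
          · simp [h']
      have : ∑ j, a j * (q j - ε * w j) = ∑ j, a j * q j - ε * u l := by
        rw [← hsum, Finset.mul_sum, ← Finset.sum_sub_distrib]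
        exact Finset.sum_congr rfl fun j _ => by rw [← haw j]; ring
      rw [this, hwl]
      linarith
    · have hwl : w l = 0 := by
        simp only [w]
        split_ifs with h
        · exact hone l fun h' => hl ⟨h', h⟩
        · rfl
      rw [hwl, mul_zero, sub_zero]
      exact (eval_mono hval hpps b (fun j => sub_nonneg.2 (hle j))
        (fun j => by linarith [hεw j]) l).trans (congrFun hq.1 l).le
  have : w m = u m := if_pos hum
  have := mul_pos hcpos (sub_pos.2 hmem)
  linarith

end PPS

section SpectralRadius

attribute [local instance] Matrix.linftyOpNormedRing Matrix.linftyOpNormedAlgebra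

/-- A nonnegative matrix without nonzero nonnegative subinvariant vectors has spectral radius
less than one. -/
theorem Matrix.spectralRadius_map_lt_one {n : ℕ} {A : Matrix (Fin n) (Fin n) ℝ}
    (hA : ∀ i j, 0 ≤ A i j)
    (h : ∀ u : Fin n → ℝ, (∀ i, 0 ≤ u i) → (∀ i, u i ≤ ∑ j, A i j * u j) → ∀ i, u i = 0) :
    spectralRadius ℂ (A.map (algebraMap ℝ ℂ)) < 1 := by
  rcases isEmpty_or_nonempty (Fin n) with hn | hn
  · have : Subsingleton (Matrix (Fin n) (Fin n) ℂ) := inferInstance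
    simp [spectralRadius, spectrum.of_subsingleton]
  refine spectrum.spectralRadius_lt_of_forall_lt (r := 1) _ fun μ hμ => ?_
  by_contra! hlt
  have hlt' : (1 : ℝ) ≤ ‖μ‖ := hlt
  rw [← Matrix.spectrum_toLin', ← Module.End.hasEigenvalue_iff_mem_spectrum] at hμ
  obtain ⟨x, hx⟩ := hμ.exists_hasEigenvector
  refine hx.2 (funext fun i => norm_eq_zero.1 (h (fun i => ‖x i‖) (fun i => norm_nonneg _)
    (fun i => ?_) i))
  have hxi := congrFun hx.apply_eq_smul i
  simp only [Matrix.toLin'_apply, Matrix.mulVec, dotProduct, Matrix.map_apply, Pi.smul_apply,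
    smul_eq_mul] at hxi
  calc ‖x i‖ ≤ ‖μ‖ * ‖x i‖ := le_mul_of_one_le_left (norm_nonneg _) hlt'
    _ = ‖∑ j, (algebraMap ℝ ℂ) (A i j) * x j‖ := by rw [hxi, norm_mul]
    _ ≤ ∑ j, ‖(algebraMap ℝ ℂ) (A i j) * x j‖ := norm_sum_le _ _
    _ = ∑ j, A i j * ‖x j‖ := Finset.sum_congr rfl fun j _ => by
      rw [norm_mul, norm_algebraMap', Real.norm_of_nonneg (hA i j)]

/-- The powers of an element of spectral radius less than one are summable. -/
theorem summable_pow_of_spectralRadius_lt_one {R : Type*} [NormedRing R] [NormedAlgebra ℂ R]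
    [CompleteSpace R] {a : R} (ha : spectralRadius ℂ a < 1) : Summable fun k : ℕ => a ^ k := by
  obtain ⟨r, hr, hr1⟩ := ENNReal.lt_iff_exists_nnreal_btwn.1 ha
  have hr1' : r < 1 := by exact_mod_cast hr1
  refine Summable.of_norm_bounded_eventually_nat
    (summable_geometric_of_lt_one r.coe_nonneg (NNReal.coe_lt_one.2 hr1')) ?_
  filter_upwards [(spectrum.pow_nnnorm_pow_one_div_tendsto_nhds_spectralRadius a).eventually
    (gt_mem_nhds hr), eventually_gt_atTop 0] with k hk hk0
  have hk' : (0 : ℝ) < k := by exact_mod_cast hk0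
  rw [one_div, ENNReal.rpow_inv_lt_iff hk', ENNReal.rpow_natCast] at hk
  have : ‖a ^ k‖₊ < r ^ k := by exact_mod_cast hk
  exact_mod_cast this.le

theorem Matrix.summable_pow_of_spectralRadius_map_lt_one {n : ℕ} {A : Matrix (Fin n) (Fin n) ℝ}
    (hA : spectralRadius ℂ (A.map (algebraMap ℝ ℂ)) < 1) : Summable fun k : ℕ => A ^ k := by
  have h := summable_pow_of_spectralRadius_lt_one hA
  refine Pi.summable.2 fun i => Pi.summable.2 fun j => ?_
  have hij := Pi.summable.1 (Pi.summable.1 h i) j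
  have he : ∀ k : ℕ, (A.map (algebraMap ℝ ℂ)) ^ k = (A ^ k).map (algebraMap ℝ ℂ) :=
    fun k => (map_pow (algebraMap ℝ ℂ).mapMatrix A k).symm
  simp only [he, Matrix.map_apply] at hij
  exact Complex.summable_ofReal.1 hij

end SpectralRadius

open PPS in
/-- Let `x = P(x)` be a PPS in SNF with LFP `q* > 0`. If `0 ≤ y ≤ q*` and `y < 1`
coordinatewise, then `ρ(P'(y)) < 1`; consequently `I - P'(y)` is nonsingular and
`(I - P'(y))⁻¹ = ∑ₖ P'(y)^k` is entrywise nonnegative. -/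
theorem stmt0 {n : ℕ} (S : Sys n) (hval : SysValid S) (hpps : IsPPS S)
    (q : Fin n → ℝ) (hq : IsLFP true S q) (hqpos : ∀ i, 0 < q i)
    (y : Fin n → ℝ) (hy0 : ∀ i, 0 ≤ y i) (hyq : ∀ i, y i ≤ q i) (hy1 : ∀ i, y i < 1) :
    spectralRadius ℂ ((jac S y).map (algebraMap ℝ ℂ)) < 1 ∧
    IsUnit (1 - jac S y) ∧
    (∀ i j, ((1 - jac S y)⁻¹) i j = ∑' k : ℕ, ((jac S y) ^ k) i j) ∧
    (∀ i j, 0 ≤ ((1 - jac S y)⁻¹) i j) := by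
  have hA : ∀ i j, 0 ≤ jac S y i j := jac_nonneg hval hy0
  have hρ := Matrix.spectralRadius_map_lt_one hA fun u hu0 hu =>
    eq_zero_of_le_mulVec hval hpps hq hqpos hy0 hyq hy1 hu0 hu
  have hsum := Matrix.summable_pow_of_spectralRadius_map_lt_one hρ
  have hinv : (1 - jac S y)⁻¹ = ∑' k : ℕ, jac S y ^ k :=
    Matrix.inv_eq_right_inv hsum.one_sub_mul_tsum_pow
  have hentry : ∀ i j, ((1 - jac S y)⁻¹) i j = ∑' k : ℕ, ((jac S y) ^ k) i j := fun i j => by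
    rw [hinv]
    exact (Pi.hasSum.1 (Pi.hasSum.1 hsum.hasSum i) j).tsum_eq.symm
  have hpow : ∀ (k : ℕ) (i j : Fin n), 0 ≤ (jac S y ^ k) i j := by
    intro k
    induction k with
    | zero =>
      intro i j
      rw [pow_zero, Matrix.one_apply]
      split_ifs <;> norm_num
    | succ k ih =>
      intro i j
      rw [pow_succ, Matrix.mul_apply]
      exact Finset.sum_nonneg fun l _ => mul_nonneg (ih i l) (hA l j)
  exact ⟨hρ, .of_mul_eq_one _ hsum.one_sub_mul_tsum_pow, hentry,
    fun i j => hentry i j ▸ tsum_nonneg fun k => hpow k i j⟩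
end

section
/- Let x = P(x) be a PPS in SNF with least fixed point q* > 0. If 0 ≤ y ≤ q* and the matrix (I − P'(y))^{-1} exists and is entrywise nonnegative (so that N(y) is defined), then N(y) ≤ q*. -/
open Matrix Finset

namespace PPS

/-- Componentwise, a PPS in SNF dominates its first-order Taylor expansion at `y` above `y`. -/
theorem eval_add_jac_mulVec_le {n : ℕ} (isMax : Bool) (S : Sys n) (hpps : IsPPS S)
    {x y : Fin n → ℝ} (hyx : ∀ i, y i ≤ x i) (i : Fin n) :
    eval isMax S y i + (jac S y *ᵥ (x - y)) i ≤ eval isMax S x i := by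
  have h := hpps i
  simp only [eval, jac, mulVec, dotProduct, of_apply, Pi.sub_apply]
  cases hS : S i with
  | lin a0 a =>
    simp only [Eqn.eval, Eqn.jacRow, mul_sub, Finset.sum_sub_distrib]
    linarith
  | quad j k =>
    simp only [Eqn.eval, Eqn.jacRow, add_mul, ite_mul, zero_mul, Finset.sum_add_distrib,
      Finset.sum_ite_eq', Finset.mem_univ, if_true]
    nlinarith [mul_nonneg (sub_nonneg.2 (hyx j)) (sub_nonneg.2 (hyx k))]
  | m j k => simp [hS, Eqn.IsLinOrQuad] at h

end PPS

open PPS in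
/-- Let `x = P(x)` be a PPS in SNF with LFP `q* > 0`. If `0 ≤ y ≤ q*` and
`(I - P'(y))⁻¹` exists and is entrywise nonnegative, then `N(y) ≤ q*`. -/
theorem stmt1 {n : ℕ} (S : Sys n) (hval : SysValid S) (hpps : IsPPS S)
    (q : Fin n → ℝ) (hq : IsLFP true S q) (hqpos : ∀ i, 0 < q i)
    (y : Fin n → ℝ) (hy0 : ∀ i, 0 ≤ y i) (hyq : ∀ i, y i ≤ q i)
    (hinv : IsUnit (1 - jac S y))
    (hpos : ∀ i j, 0 ≤ ((1 - jac S y)⁻¹) i j) :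
    ∀ i, newton true S y i ≤ q i := by
  have hdet : IsUnit (1 - jac S y).det := (Matrix.isUnit_iff_isUnit_det _).1 hinv
  have hsub : q - newton true S y =
      (1 - jac S y)⁻¹ *ᵥ (q - eval true S y - jac S y *ᵥ (q - y)) := by
    have hcancel : (1 - jac S y)⁻¹ *ᵥ ((1 - jac S y) *ᵥ (q - y)) = q - y := by
      rw [mulVec_mulVec, nonsing_inv_mul _ hdet, one_mulVec]
    have hsplit : q - eval true S y - jac S y *ᵥ (q - y) =
        (1 - jac S y) *ᵥ (q - y) - (eval true S y - y) := by
      rw [sub_mulVec, one_mulVec]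
      abel
    rw [hsplit, mulVec_sub, hcancel, newton]
    abel
  intro i
  rw [← sub_nonneg, ← Pi.sub_apply, hsub]
  simp only [mulVec, dotProduct]
  refine Finset.sum_nonneg fun j _ => mul_nonneg (hpos i j) ?_
  have hle := eval_add_jac_mulVec_le true S hpps hyq j
  rw [hq.1] at hle
  simp only [Pi.sub_apply]
  linarith
end

section
/- Let x = P(x) be a PPS in SNF and let y ∈ ℝ^n be such that (I − P'(y))^{-1} exists and is entrywise nonnegative. Then: (i) N(y) is defined and is the unique point a ∈ ℝ^n satisfying P^y(a) = a; (ii) for any vector x ∈ ℝ^n, if P^y(x) ≥ x then x ≤ N(y), and if P^y(x) ≤ x then x ≥ N(y). -/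
open Matrix Finset

namespace PPS

/-- The linearization at `y` is the first-order Taylor polynomial of `P` at `y`. -/
theorem linEval_eq_eval_add_jac_mulVec {n : ℕ} (isMax : Bool) {S : Sys n} (hS : IsPPS S)
    (y x : Fin n → ℝ) :
    linEval isMax S y x = eval isMax S y + jac S y *ᵥ (x - y) := by
  ext i
  have hi := hS i
  simp only [linEval, eval, jac, Pi.add_apply, mulVec, dotProduct, of_apply, Pi.sub_apply]
  cases h : S i with
  | lin a0 a =>
    simp only [Eqn.eval, Eqn.jacRow, mul_sub, sum_sub_distrib]
    ring
  | quad j k =>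
    simp only [Eqn.eval, Eqn.jacRow, add_mul, ite_mul, zero_mul, sum_add_distrib,
      sum_ite_eq', mem_univ, if_true]
    ring
  | m j k => simp [h, Eqn.IsLinOrQuad] at hi

/-- The inverse of `I - P'(y)` sends the residual `P^y(x) - x` to `N(y) - x`. -/
theorem inv_mulVec_linEval_sub_self {n : ℕ} (isMax : Bool) {S : Sys n} (hS : IsPPS S)
    {y : Fin n → ℝ} (hinv : IsUnit (1 - jac S y)) (x : Fin n → ℝ) :
    (1 - jac S y)⁻¹ *ᵥ (linEval isMax S y x - x) = newton isMax S y - x := by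
  have hres : linEval isMax S y x - x =
      (eval isMax S y - y) - (1 - jac S y) *ᵥ (x - y) := by
    rw [linEval_eq_eval_add_jac_mulVec isMax hS, sub_mulVec, one_mulVec]
    abel
  rw [hres, mulVec_sub, mulVec_mulVec,
    nonsing_inv_mul _ ((isUnit_iff_isUnit_det _).mp hinv), one_mulVec, newton]
  abel

end PPS

open PPS in
/-- Let `x = P(x)` be a PPS in SNF and `y` such that `(I - P'(y))⁻¹` exists and is
entrywise nonnegative.  Then (i) `N(y)` is defined and is the unique point `a` with
`P^y(a) = a`; (ii) for any `x`, if `P^y(x) ≥ x` then `x ≤ N(y)`, and if `P^y(x) ≤ x`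
then `x ≥ N(y)`. -/
theorem stmt3 {n : ℕ} (S : Sys n) (hval : SysValid S) (hpps : IsPPS S)
    (y : Fin n → ℝ) (hinv : IsUnit (1 - jac S y))
    (hpos : ∀ i j, 0 ≤ ((1 - jac S y)⁻¹) i j) :
    (linEval true S y (newton true S y) = newton true S y ∧
      ∀ a : Fin n → ℝ, linEval true S y a = a → a = newton true S y) ∧
    (∀ x : Fin n → ℝ,
      ((∀ i, x i ≤ linEval true S y x i) → ∀ i, x i ≤ newton true S y i) ∧
      ((∀ i, linEval true S y x i ≤ x i) → ∀ i, newton true S y i ≤ x i)) := by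
  have key := inv_mulVec_linEval_sub_self true hpps hinv
  have hmono (v : Fin n → ℝ) (hv : ∀ i, 0 ≤ v i) (i : Fin n) :
      0 ≤ ((1 - jac S y)⁻¹ *ᵥ v) i := by
    rw [mulVec, dotProduct]
    exact sum_nonneg fun j _ => mul_nonneg (hpos i j) (hv j)
  refine ⟨⟨?_, fun a ha => ?_⟩, fun x => ⟨fun hx i => ?_, fun hx i => ?_⟩⟩
  · have hinv' : IsUnit (1 - jac S y)⁻¹ := isUnit_nonsing_inv_iff.mpr hinv
    have h := key (newton true S y)
    rw [sub_self] at h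
    exact sub_eq_zero.mp (mulVec_injective_of_isUnit hinv' (h.trans (mulVec_zero _).symm))
  · have h := key a
    rw [ha, sub_self, mulVec_zero] at h
    exact (sub_eq_zero.mp h.symm).symm
  · have h := hmono (linEval true S y x - x) (fun i => sub_nonneg.mpr (hx i)) i
    rw [key x] at h
    exact sub_nonneg.mp h
  · have h := hmono (-(linEval true S y x - x))
      (fun i => by simpa using hx i) i
    rw [mulVec_neg, key x, neg_sub] at h
    exact sub_nonneg.mp h
end

section
/- Let x = P(x) be a maxPPS in SNF with least fixed point q* satisfying 0 < q* < 1. For any x ∈ ℝ^n with 0 ≤ x ≤ q* and any λ > 0, letting I(x) denote the least fixed point of the linearized system z = P^x(z), we have I(x) ≤ q*, and furthermore if q* − x ≤ λ(1 − q*) then q* − I(x) ≤ (λ/2)(1 − q*). -/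
open Matrix Finset

/-- Knaster–Tarski for a map that is monotone above `b` and sends its pre-fixed points
above `b` to points above `b`. -/
theorem exists_fixedPoint_le {α : Type*} [ConditionallyCompleteLattice α] {F : α → α} {b y : α}
    (hmono : MonotoneOn F (Set.Ici b)) (hb : ∀ z, b ≤ z → F z ≤ z → b ≤ F z)
    (hby : b ≤ y) (hy : F y ≤ y) : ∃ z, F z = z ∧ b ≤ z ∧ z ≤ y := by
  have hbdd : BddBelow {z | b ≤ z ∧ F z ≤ z} := ⟨b, fun z hz => hz.1⟩
  set w := sInf {z | b ≤ z ∧ F z ≤ z} with hw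
  have hbw : b ≤ w := le_csInf ⟨y, hby, hy⟩ fun z hz => hz.1
  have hFw : F w ≤ w := le_csInf ⟨y, hby, hy⟩ fun z hz =>
    (hmono hbw hz.1 (csInf_le hbdd hz)).trans hz.2
  have hbF : b ≤ F w := hb w hbw hFw
  exact ⟨w, hFw.antisymm (csInf_le hbdd ⟨hbF, hmono hbF hbw hFw⟩), hbw,
    csInf_le hbdd ⟨hby, hy⟩⟩

namespace PPS

variable {n : ℕ} {S : Sys n}

theorem eval_monotoneOn (hval : SysValid S) :
    MonotoneOn (eval true S) (Set.Ici (0 : Fin n → ℝ)) := by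
  intro y hy z hz hyz i
  have hvi := hval i
  simp only [eval]
  cases hS : S i with
  | lin a0 a =>
    rw [hS] at hvi
    simp only [Eqn.eval]
    gcongr with j
    · exact hvi.2.1 j
    · exact hyz j
  | quad j k => exact mul_le_mul (hyz j) (hyz k) (hy k) (hz j)
  | m j k => simpa only [Eqn.eval, if_true] using max_le_max (hyz j) (hyz k)

theorem eval_nonneg_s5 (hval : SysValid S) {y : Fin n → ℝ} (hy : 0 ≤ y) : 0 ≤ eval true S y := by
  intro i
  have hvi := hval i
  simp only [eval, Pi.zero_apply]
  cases hS : S i with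
  | lin a0 a =>
    rw [hS] at hvi
    exact add_nonneg hvi.1 (Finset.sum_nonneg fun j _ => mul_nonneg (hvi.2.1 j) (hy j))
  | quad j k => exact mul_nonneg (hy j) (hy k)
  | m j k => exact (hy j).trans (le_max_left _ _)

theorem linEval_monotone (hval : SysValid S) {x : Fin n → ℝ} (hx0 : ∀ i, 0 ≤ x i) :
    Monotone (linEval true S x) := by
  intro y z hyz i
  have hvi := hval i
  simp only [linEval]
  cases hS : S i with
  | lin a0 a =>
    rw [hS] at hvi
    simp only [Eqn.eval]
    gcongr with j
    · exact hvi.2.1 j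
    · exact hyz j
  | quad j k =>
    have h1 := mul_le_mul_of_nonneg_left (hyz k) (hx0 j)
    have h2 := mul_le_mul_of_nonneg_right (hyz j) (hx0 k)
    dsimp only
    linarith
  | m j k => simpa only [Eqn.eval, if_true] using max_le_max (hyz j) (hyz k)

theorem linEval_le_eval {x y : Fin n → ℝ} (hxy : ∀ i, x i ≤ y i) :
    linEval true S x y ≤ eval true S y := by
  intro i
  simp only [linEval, eval]
  cases S i with
  | lin a0 a => exact le_rfl
  | quad j k =>
    simp only [Eqn.eval]
    nlinarith [mul_nonneg (sub_nonneg.2 (hxy j)) (sub_nonneg.2 (hxy k))]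
  | m j k => exact le_rfl

/-- The least fixed point lies below every pre-fixed point in the unit cube. -/
theorem IsLFP.le_of_eval_le_s5 {q y : Fin n → ℝ} (hval : SysValid S) (hq : IsLFP true S q)
    (hy0 : ∀ i, 0 ≤ y i) (hy1 : ∀ i, y i ≤ 1) (hy : ∀ i, eval true S y i ≤ y i) (i : Fin n) :
    q i ≤ y i := by
  obtain ⟨z, hz, hz0, hzy⟩ := exists_fixedPoint_le (eval_monotoneOn hval)
    (fun z hz _ => eval_nonneg_s5 hval hz) hy0 hy
  exact (hq.2.2.2 z hz hz0 (fun j => (hzy j).trans (hy1 j)) i).trans (hzy i)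

theorem exists_pos_gap {q : Fin n → ℝ} (h0 : ∀ i, 0 < q i) :
    ∃ ε > 0, (∀ i, ε ≤ q i) ∧ ∀ i j, q j < q i → q j ≤ q i - ε := by
  have key : ∀ᶠ ε in nhdsWithin (0 : ℝ) (Set.Ioi 0),
      0 < ε ∧ (∀ i, ε ≤ q i) ∧ ∀ i j, q j < q i → q j ≤ q i - ε := by
    have hsmall : ∀ r : ℝ, 0 < r → ∀ᶠ ε in nhdsWithin (0 : ℝ) (Set.Ioi 0), ε ≤ r := fun r hr =>
      nhdsWithin_le_nhds (eventually_le_nhds hr)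
    refine Filter.Eventually.and self_mem_nhdsWithin (Filter.Eventually.and ?_ ?_)
    · exact Filter.eventually_all.2 fun i => hsmall _ (h0 i)
    · refine Filter.eventually_all.2 fun i => Filter.eventually_all.2 fun j => ?_
      by_cases h : q j < q i
      · filter_upwards [hsmall _ (sub_pos.2 h)] with ε hε _
        linarith
      · exact Filter.Eventually.of_forall fun _ h' => absurd h' h
  obtain ⟨ε, h⟩ := key.exists
  exact ⟨ε, h.1, h.2⟩

/-- Pre-fixed points of the linearization at `x` are bounded below in terms of the distance
from `x` to the least fixed point. -/
theorem sub_le_of_linEval_le {q x z : Fin n → ℝ} (hval : SysValid S) (hq : IsLFP true S q)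
    (h0 : ∀ i, 0 < q i) (h1 : ∀ i, q i < 1) (hx0 : ∀ i, 0 ≤ x i) (hxq : ∀ i, x i ≤ q i)
    {lam : ℝ} (hlam : 0 < lam) (hz : ∀ i, linEval true S x z i ≤ z i)
    (hd : ∀ i, q i - x i ≤ lam * (1 - q i)) (i : Fin n) :
    q i - z i ≤ (lam / 2) * (1 - q i) := by
  by_contra! hi
  have hv : ∀ i, 0 < 1 - q i := fun i => sub_pos.2 (h1 i)
  have : Nonempty (Fin n) := ⟨i⟩
  obtain ⟨t, ht⟩ := Finite.exists_max fun i => (q i - z i) / (1 - q i)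
  obtain ⟨c, hc⟩ : ∃ c, c = (q t - z t) / (1 - q t) := ⟨_, rfl⟩
  have hu : ∀ j, q j - z j ≤ c * (1 - q j) := fun j => by
    rw [← div_le_iff₀ (hv j), hc]
    exact ht j
  have htc : q t - z t = c * (1 - q t) := by
    rw [hc, div_mul_cancel₀ _ (hv t).ne']
  have hlc : lam / 2 < c := lt_of_mul_lt_mul_right (hi.trans_le (hu i)) (hv i).le
  have hc0 : 0 < c := (half_pos hlam).trans hlc
  obtain ⟨ε, hε, hεq, hgap⟩ := exists_pos_gap h0
  -- Lower `q` proportionally to `1 - q` on the set where the ratio is maximal.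
  let y : Fin n → ℝ := fun j => if q j - z j = c * (1 - q j) then q j - ε * (1 - q j) else q j
  have hy_le : ∀ j, y j ≤ q j := fun j => by
    have := mul_pos hε (hv j)
    dsimp only [y]
    split_ifs <;> linarith
  have hy_nonneg : ∀ j, 0 ≤ y j := fun j => by
    have := h0 j
    dsimp only [y]
    split_ifs
    · nlinarith [hεq j]
    · exact this.le
  have hqfix : ∀ j, eval true S q j = q j := fun j => congrFun hq.1 j
  have hy : ∀ j, eval true S y j ≤ y j := by
    intro j
    by_cases hj : q j - z j = c * (1 - q j)
    swap
    · have : y j = q j := if_neg hj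
      rw [this, ← hqfix j]
      exact eval_monotoneOn hval hy_nonneg (fun l => (h0 l).le) hy_le j
    have hyj : y j = q j - ε * (1 - q j) := if_pos hj
    rw [hyj]
    have hqj := hqfix j
    have hzj := hz j
    have hvj := hval j
    simp only [eval, linEval] at hqj hzj ⊢
    cases hS : S j with
    | lin a0 a =>
      rw [hS] at hqj hzj hvj
      obtain ⟨-, ha, hsum⟩ := hvj
      simp only [Eqn.eval] at hqj hzj ⊢
      have hnn : ∀ l ∈ Finset.univ, 0 ≤ a l * (c * (1 - q l) - (q l - z l)) := fun l _ =>
        mul_nonneg (ha l) (sub_nonneg.2 (hu l))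
      have hexp : ∑ l, a l * (c * (1 - q l) - (q l - z l))
          = c * (∑ l, a l - ∑ l, a l * q l) - (∑ l, a l * q l - ∑ l, a l * z l) := by
        simp only [Finset.mul_sum, ← Finset.sum_sub_distrib]
        exact Finset.sum_congr rfl fun l _ => by ring
      have hpos := Finset.sum_nonneg hnn
      have hle : c * (∑ l, a l - ∑ l, a l * q l) ≤ c * (1 - q j) :=
        mul_le_mul_of_nonneg_left (by linarith) hc0.le
      have hzero := (Finset.sum_eq_zero_iff_of_nonneg hnn).1 (by linarith)
      have hge : 1 - q j ≤ ∑ l, a l - ∑ l, a l * q l :=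
        le_of_mul_le_mul_left (by linarith) hc0
      have hay : ∑ l, a l * y l
          = ∑ l, a l * q l - ε * (∑ l, a l - ∑ l, a l * q l) := by
        simp only [Finset.mul_sum, ← Finset.sum_sub_distrib]
        refine Finset.sum_congr rfl fun l hl => ?_
        rcases mul_eq_zero.1 (hzero l hl) with h | h
        · simp [h]
        · have : y l = q l - ε * (1 - q l) := if_pos (by linarith)
          rw [this]
          ring
      have := mul_le_mul_of_nonneg_left hge hε.le
      linarith
    | quad k l =>
      exfalso
      rw [hS] at hqj hzj
      simp only [Eqn.eval] at hqj hzj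
      have e1 := mul_le_mul_of_nonneg_left (hu l) (hx0 k)
      have e2 := mul_le_mul_of_nonneg_left (hu k) (hx0 l)
      have dk := sub_nonneg.2 (hxq k)
      have dl := sub_nonneg.2 (hxq l)
      have e3 := mul_le_mul_of_nonneg_right (hd k) dl
      have e4 := mul_le_mul_of_nonneg_right (hd l) dk
      have e5 : 0 < c * ((1 - q k) * (1 - q l)) := mul_pos hc0 (mul_pos (hv k) (hv l))
      have e6 : 0 ≤ (c - lam / 2) * ((1 - q k) * (q l - x l) + (1 - q l) * (q k - x k)) :=
        mul_nonneg (sub_pos.2 hlc).le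
          (add_nonneg (mul_nonneg (hv k).le dl) (mul_nonneg (hv l).le dk))
      have e7 : q j - z j = c * (1 - q k * q l) := by rw [hj, hqj]
      nlinarith
    | m k l =>
      rw [hS] at hqj hzj
      simp only [Eqn.eval, if_true] at hqj hzj ⊢
      have hbranch : ∀ r, q r ≤ q j → z r ≤ z j → y r ≤ q j - ε * (1 - q j) := by
        intro r hr hzr
        rcases hr.lt_or_eq with h | h
        · have := hgap j r h
          have := hy_le r
          nlinarith [h0 j]
        · have hur := hu r
          rw [h] at hur
          have : y r = q r - ε * (1 - q r) := if_pos (by rw [h]; linarith)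
          rw [this, h]
      exact max_le (hbranch k (hqj ▸ le_max_left _ _) ((le_max_left _ _).trans hzj))
        (hbranch l (hqj ▸ le_max_right _ _) ((le_max_right _ _).trans hzj))
  have hqy := hq.le_of_eval_le_s5 hval hy_nonneg (fun j => (hy_le j).trans (h1 j).le) hy t
  have hyt : y t = q t - ε * (1 - q t) := if_pos htc
  have := mul_pos hε (hv t)
  linarith

end PPS

open PPS in
/-- Let `x = P(x)` be a maxPPS in SNF with LFP `0 < q* < 1`.  For any `0 ≤ x ≤ q*` and
`λ > 0`, letting `I(x)` be the least fixed point of the linearized system `z = P^x(z)`,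
we have `I(x) ≤ q*`, and if `q* - x ≤ λ(1 - q*)` then `q* - I(x) ≤ (λ/2)(1 - q*)`. -/
theorem stmt5 {n : ℕ} (S : Sys n) (hval : SysValid S)
    (q : Fin n → ℝ) (hq : IsLFP true S q) (h0 : ∀ i, 0 < q i) (h1 : ∀ i, q i < 1)
    (x : Fin n → ℝ) (hx0 : ∀ i, 0 ≤ x i) (hxq : ∀ i, x i ≤ q i)
    (lam : ℝ) (hlam : 0 < lam)
    (Ix : Fin n → ℝ) (hfix : linEval true S x Ix = Ix)
    (hleast : ∀ z : Fin n → ℝ, linEval true S x z = z → ∀ i, Ix i ≤ z i) :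
    (∀ i, Ix i ≤ q i) ∧
    ((∀ i, q i - x i ≤ lam * (1 - q i)) →
      ∀ i, q i - Ix i ≤ (lam / 2) * (1 - q i)) := by
  have hqpre : linEval true S x q ≤ q := (linEval_le_eval hxq).trans hq.1.le
  have hmono := linEval_monotone hval hx0
  refine ⟨fun i => ?_, fun hd =>
    sub_le_of_linEval_le hval hq h0 h1 hx0 hxq hlam (fun j => (congrFun hfix j).le) hd⟩
  have : Nonempty (Fin n) := ⟨i⟩
  obtain ⟨t, ht⟩ := Finite.exists_max fun j => (q j - x j) / (1 - q j)
  obtain ⟨L, hL, hL'⟩ : ∃ L > 0, (q t - x t) / (1 - q t) ≤ L :=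
    ⟨max 1 _, lt_max_of_lt_left one_pos, le_max_right _ _⟩
  have hd : ∀ j, q j - x j ≤ L * (1 - q j) := fun j =>
    (div_le_iff₀ (sub_pos.2 (h1 j))).1 ((ht j).trans hL')
  have hbound : ∀ z, linEval true S x z ≤ z → (fun j => q j - (L / 2) * (1 - q j)) ≤ z :=
    fun z hz j => by
      have := sub_le_of_linEval_le hval hq h0 h1 hx0 hxq hL hz hd j
      dsimp only
      linarith
  obtain ⟨z, hz, -, hzq⟩ := exists_fixedPoint_le (hmono.monotoneOn _)
    (fun z _ hz => hbound _ (hmono hz)) (hbound q hqpre) hqpre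
  exact (hleast z hz i).trans (hzq i)
end

section
/- Let x = P(x) be a PPS in SNF and let x, y ∈ ℝ^n satisfy 0 ≤ x ≤ y ≤ P(y) ≤ 1. Suppose λ > 0, y − x ≤ λ(1 − y), and (I − P'(x))^{-1} exists and is entrywise nonnegative. Then y − N(x) ≤ (λ/2)(1 − y). -/
open Matrix Finset

namespace PPS

/-- The Jacobian of an SNF equation bounds the second-order remainder of a Newton step:
the defect between `x` and `y` is at most `lam / 2` times the slack of the
linearization at `x` in the direction `1 - y`. -/
lemma Eqn.sub_jacRow_dotProduct_le {n : ℕ} (e : Eqn n) (hval : e.Valid)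
    (hpps : e.IsLinOrQuad) (x y : Fin n → ℝ) (hxy : ∀ i, x i ≤ y i) (hy1 : ∀ i, y i ≤ 1)
    (lam : ℝ) (hlam : 0 ≤ lam) (hgap : ∀ i, y i - x i ≤ lam * (1 - y i)) (b : Bool) :
    e.eval b y - e.eval b x - e.jacRow x ⬝ᵥ (y - x)
      ≤ lam / 2 * (1 - e.eval b y - e.jacRow x ⬝ᵥ (1 - y)) := by
  cases e with
  | lin a0 a =>
    obtain ⟨-, -, hs⟩ := hval
    simp only [Eqn.eval, Eqn.jacRow, dotProduct, Pi.sub_apply, Pi.one_apply, mul_sub, mul_one,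
      Finset.sum_sub_distrib]
    have : 0 ≤ lam * (1 - (a0 + ∑ j, a j)) := mul_nonneg hlam (by linarith)
    linarith
  | quad j k =>
    simp only [Eqn.eval, Eqn.jacRow, dotProduct, Pi.sub_apply, Pi.one_apply, add_mul, ite_mul,
      zero_mul, Finset.sum_add_distrib, Finset.sum_ite_eq', Finset.mem_univ, if_true]
    have h₁ := mul_le_mul_of_nonneg_right (hgap j) (sub_nonneg.2 (hxy k))
    have h₂ := mul_le_mul_of_nonneg_right (hgap k) (sub_nonneg.2 (hxy j))
    have h₃ : 0 ≤ lam * ((1 - y j) * (1 - y k)) :=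
      mul_nonneg hlam (mul_nonneg (sub_nonneg.2 (hy1 j)) (sub_nonneg.2 (hy1 k)))
    linarith
  | m j k => exact hpps.elim

end PPS

open PPS in
/-- Let `x = P(x)` be a PPS in SNF and `0 ≤ x ≤ y ≤ P(y) ≤ 1`.  Suppose `λ > 0`,
`y - x ≤ λ(1 - y)`, and `(I - P'(x))⁻¹` exists and is entrywise nonnegative.
Then `y - N(x) ≤ (λ/2)(1 - y)`. -/
theorem stmt11 {n : ℕ} (S : Sys n) (hval : SysValid S) (hpps : IsPPS S)
    (x y : Fin n → ℝ) (hx0 : ∀ i, 0 ≤ x i) (hxy : ∀ i, x i ≤ y i)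
    (hyP : ∀ i, y i ≤ eval true S y i) (hP1 : ∀ i, eval true S y i ≤ 1)
    (lam : ℝ) (hlam : 0 < lam)
    (hgap : ∀ i, y i - x i ≤ lam * (1 - y i))
    (hinv : IsUnit (1 - jac S x))
    (hpos : ∀ i j, 0 ≤ ((1 - jac S x)⁻¹) i j) :
    ∀ i, y i - newton true S x i ≤ (lam / 2) * (1 - y i) := by
  have hy1 : ∀ i, y i ≤ 1 := fun i => (hyP i).trans (hP1 i)
  set A := 1 - jac S x with hA
  set z := y - newton true S x - (lam / 2) • (1 - y) with hz
  have hdet : IsUnit A.det := (Matrix.isUnit_iff_isUnit_det A).1 hinv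
  have hAz : A *ᵥ z = (y - x) - jac S x *ᵥ (y - x) - (eval true S x - x)
      - (lam / 2) • ((1 - y) - jac S x *ᵥ (1 - y)) := by
    have hN : A *ᵥ newton true S x = A *ᵥ x + (eval true S x - x) := by
      rw [newton, ← hA, mulVec_add, mulVec_mulVec, mul_nonsing_inv A hdet, one_mulVec]
    have hsub : ∀ v, A *ᵥ v = v - jac S x *ᵥ v := fun v => by
      rw [hA, sub_mulVec, one_mulVec]
    rw [hz, mulVec_sub, mulVec_sub, mulVec_smul, hN, ← hsub, ← hsub, mulVec_sub A y x]
    abel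
  have hAz0 : ∀ i, (A *ᵥ z) i ≤ 0 := fun i => by
    have h := (S i).sub_jacRow_dotProduct_le (hval i) (hpps i) x y hxy hy1 lam hlam.le hgap true
    have hyi : y i ≤ (S i).eval true y := hyP i
    have hl := mul_le_mul_of_nonneg_left hyi hlam.le
    have hi : (A *ᵥ z) i = (y i - x i) - (S i).jacRow x ⬝ᵥ (y - x) - ((S i).eval true x - x i)
        - lam / 2 * ((1 - y i) - (S i).jacRow x ⬝ᵥ (1 - y)) := by
      rw [hAz]; rfl
    linarith
  intro i
  have hzA : z = A⁻¹ *ᵥ (A *ᵥ z) := by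
    rw [mulVec_mulVec, nonsing_inv_mul A hdet, one_mulVec]
  have hzi : z i ≤ 0 := by
    rw [hzA]
    change ∑ j, A⁻¹ i j * (A *ᵥ z) j ≤ 0
    exact Finset.sum_nonpos fun j _ => mul_nonpos_of_nonneg_of_nonpos (hpos i j) (hAz0 j)
  exact sub_nonpos.1 hzi
end
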